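/- arXiv:1904.03136 — 4 statements merged into one kernel-verified Lean document; each statement's English description precedes it below -/
import Mathlib

section
/- For each θ ∈ M there exists a unique triple (R, S, B) of matrices in ℝ^{n1×n2} such that: θ = R + S + B; R D̃ᵀ = 0 (each row of R is constant) and D S = 0 (each column of S is constant); and S_{i,1} = B_{i,1} = B_{1,j} = 0 for all i ∈ {1,…,n1}, j ∈ {1,…,n2}. Moreover this B satisfies: B ∈ M (B is anti-Monge); B is bivariate isotonic, i.e., B_{i,j} ≤ B_{i,j+1} and B_{i,j} ≤ B_{i+1,j} for all valid indices; max{‖R‖_∞, ‖S‖_∞, ‖B‖_∞} ≤ 4‖θ‖_∞; and ‖B‖_∞ = B_{n1,n2} = V(θ). -/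
open Matrix

noncomputable section

/-- The first-order difference matrix `D ∈ ℝ^{(n-1)×n}` (here with `n = m+2`). -/
def diffMat (m : ℕ) : Matrix (Fin (m+1)) (Fin (m+2)) ℝ :=
  Matrix.of fun i j => if j = i.castSucc then -1 else if j = i.succ then 1 else 0

/-- The anti-Monge cone `M = {θ : D θ D̃ᵀ ≥ 0 entrywise}`. -/
def antiMonge (m1 m2 : ℕ) : Set (Matrix (Fin (m1+2)) (Fin (m2+2)) ℝ) :=
  {θ | ∀ (a : Fin (m1+1)) (b : Fin (m2+1)), 0 ≤ (diffMat m1 * θ * (diffMat m2)ᵀ) a b}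

/-- `V(θ) = θ_{1,1} + θ_{n1,n2} - θ_{n1,1} - θ_{1,n2}`. -/
def Vtot {m1 m2 : ℕ} (θ : Matrix (Fin (m1+2)) (Fin (m2+2)) ℝ) : ℝ :=
  θ 0 0 + θ (Fin.last (m1+1)) (Fin.last (m2+1))
    - θ (Fin.last (m1+1)) 0 - θ 0 (Fin.last (m2+1))

/-- `‖θ‖_∞`, the maximal absolute value of an entry. -/
def linf {a b : ℕ} (M : Matrix (Fin a) (Fin b) ℝ) : ℝ := ⨆ i, ⨆ j, |M i j|

/-- The defining conditions of the decomposition `θ = R + S + B`: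
`R D̃ᵀ = 0` (constant rows), `D S = 0` (constant columns), and
`S_{i,1} = B_{i,1} = B_{1,j} = 0`. -/
def decompCond (m1 m2 : ℕ) (θ : Matrix (Fin (m1+2)) (Fin (m2+2)) ℝ)
    (RSB : Matrix (Fin (m1+2)) (Fin (m2+2)) ℝ × Matrix (Fin (m1+2)) (Fin (m2+2)) ℝ ×
      Matrix (Fin (m1+2)) (Fin (m2+2)) ℝ) : Prop :=
  θ = RSB.1 + RSB.2.1 + RSB.2.2 ∧
  RSB.1 * (diffMat m2)ᵀ = 0 ∧
  diffMat m1 * RSB.2.1 = 0 ∧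
  (∀ i, RSB.2.1 i 0 = 0) ∧ (∀ i, RSB.2.2 i 0 = 0) ∧ (∀ j, RSB.2.2 0 j = 0)

lemma diffMat_mul_apply {m : ℕ} {ι : Type*} (M : Matrix (Fin (m+2)) ι ℝ) (a : Fin (m+1)) (b : ι) :
    (diffMat m * M) a b = M a.succ b - M a.castSucc b := by
  have hne : a.succ ≠ a.castSucc := a.castSucc_lt_succ.ne'
  rw [Matrix.mul_apply, Finset.sum_eq_add a.succ a.castSucc hne]
  · simp [diffMat, hne, sub_eq_add_neg]
  · rintro c - ⟨h₁, h₂⟩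
    simp [diffMat, h₁, h₂]
  · simp
  · simp

lemma mul_diffMat_transpose_apply {m : ℕ} {ι : Type*} (M : Matrix ι (Fin (m+2)) ℝ)
    (a : ι) (b : Fin (m+1)) :
    (M * (diffMat m)ᵀ) a b = M a b.succ - M a b.castSucc := by
  rw [← Matrix.transpose_transpose M, ← Matrix.transpose_mul, Matrix.transpose_apply,
    diffMat_mul_apply]
  simp

lemma mem_antiMonge_iff {m1 m2 : ℕ} {θ : Matrix (Fin (m1+2)) (Fin (m2+2)) ℝ} :
    θ ∈ antiMonge m1 m2 ↔ ∀ (a : Fin (m1+1)) (b : Fin (m2+1)),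
      0 ≤ θ a.succ b.succ - θ a.castSucc b.succ
        - (θ a.succ b.castSucc - θ a.castSucc b.castSucc) := by
  simp only [antiMonge, Set.mem_ofPred_eq, mul_diffMat_transpose_apply, diffMat_mul_apply]

/-- Anti-Monge matrices have nonnegative mixed differences over arbitrary rectangles. -/
lemma sub_le_sub_of_mem_antiMonge {m1 m2 : ℕ} {θ : Matrix (Fin (m1+2)) (Fin (m2+2)) ℝ}
    (hθ : θ ∈ antiMonge m1 m2) {i i' : Fin (m1+2)} {j j' : Fin (m2+2)} (hi : i ≤ i')
    (hj : j ≤ j') : θ i' j - θ i j ≤ θ i' j' - θ i j' := by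
  have hcol (a : Fin (m1+1)) : Monotone fun j => θ a.succ j - θ a.castSucc j :=
    Fin.monotone_iff_le_succ.2 fun b => by
      linarith [mem_antiMonge_iff.1 hθ a b]
  have hrow : Monotone fun i => θ i j' - θ i j :=
    Fin.monotone_iff_le_succ.2 fun a => by
      linarith [hcol a hj]
  linarith [hrow hi]

lemma eq_apply_zero_of_succ_eq {α : Type*} {m : ℕ} {f : Fin (m+2) → α}
    (h : ∀ a : Fin (m+1), f a.succ = f a.castSucc) (i : Fin (m+2)) : f i = f 0 := by
  induction i using Fin.induction with
  | zero => rfl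
  | succ a ih => rw [h a, ih]

/-- The decomposition is given explicitly by the first row and column of `θ`. -/
lemma decompCond_iff {m1 m2 : ℕ} {θ R S B : Matrix (Fin (m1+2)) (Fin (m2+2)) ℝ} :
    decompCond m1 m2 θ (R, S, B) ↔
      (∀ i j, R i j = θ i 0) ∧ (∀ i j, S i j = θ 0 j - θ 0 0) ∧
        ∀ i j, B i j = θ i j - θ i 0 - θ 0 j + θ 0 0 := by
  constructor
  · rintro ⟨hsum, hR, hS, hS0, hB0, hB0'⟩
    dsimp only at hsum hR hS hS0 hB0 hB0'
    have hθ i j : θ i j = R i j + S i j + B i j := by rw [hsum]; rfl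
    have hRc i j : R i j = R i 0 := eq_apply_zero_of_succ_eq (fun b => by
      rw [← sub_eq_zero, ← mul_diffMat_transpose_apply, hR]; rfl) j
    have hSc i j : S i j = S 0 j := eq_apply_zero_of_succ_eq (f := fun i => S i j) (fun a => by
      rw [← sub_eq_zero, ← diffMat_mul_apply, hS]; rfl) i
    refine ⟨fun i j => ?_, fun i j => ?_, fun i j => ?_⟩
    · linarith [hθ i 0, hRc i j, hS0 i, hB0 i]
    · linarith [hθ 0 j, hθ 0 0, hRc 0 j, hSc i j, hS0 0, hB0 0, hB0' j]
    · linarith [hθ i j, hθ i 0, hθ 0 j, hθ 0 0, hRc i j, hRc 0 j, hSc i j, hS0 i, hS0 0,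
        hB0 i, hB0 0, hB0' j]
  · rintro ⟨hR, hS, hB⟩
    refine ⟨?_, ?_, ?_, ?_, ?_, ?_⟩
    · ext i j
      simp only [Matrix.add_apply, hR, hS, hB]
      ring
    · ext a b
      simp [mul_diffMat_transpose_apply, hR]
    · ext a b
      simp [diffMat_mul_apply, hS]
    · simp [hS]
    · simp [hB]
    · simp [hB]

lemma abs_apply_le_linf {a b : ℕ} (M : Matrix (Fin a) (Fin b) ℝ) (i : Fin a) (j : Fin b) :
    |M i j| ≤ linf M :=
  (le_ciSup (f := fun j => |M i j|) (Set.finite_range _).bddAbove j).trans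
    (le_ciSup (f := fun i => ⨆ j, |M i j|) (Set.finite_range _).bddAbove i)

lemma linf_le {a b : ℕ} {M : Matrix (Fin (a+1)) (Fin (b+1)) ℝ} {c : ℝ}
    (h : ∀ i j, |M i j| ≤ c) : linf M ≤ c :=
  ciSup_le fun i => ciSup_le fun j => h i j

/-- For each anti-Monge `θ` there is a unique triple `(R, S, B)` with `θ = R + S + B`,
`R D̃ᵀ = 0`, `D S = 0`, and `S_{i,1} = B_{i,1} = B_{1,j} = 0`.  Moreover this `B` is
anti-Monge, bivariate isotonic, `max{‖R‖_∞, ‖S‖_∞, ‖B‖_∞} ≤ 4‖θ‖_∞`,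
and `‖B‖_∞ = B_{n1,n2} = V(θ)`. -/
theorem antiMonge_decomposition (m1 m2 : ℕ) (θ : Matrix (Fin (m1+2)) (Fin (m2+2)) ℝ)
    (hθ : θ ∈ antiMonge m1 m2) :
    (∃! RSB : Matrix (Fin (m1+2)) (Fin (m2+2)) ℝ × Matrix (Fin (m1+2)) (Fin (m2+2)) ℝ ×
        Matrix (Fin (m1+2)) (Fin (m2+2)) ℝ, decompCond m1 m2 θ RSB) ∧
    (∀ R S B : Matrix (Fin (m1+2)) (Fin (m2+2)) ℝ, decompCond m1 m2 θ (R, S, B) →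
      B ∈ antiMonge m1 m2 ∧
      (∀ (i : Fin (m1+2)) (j j' : Fin (m2+2)), j ≤ j' → B i j ≤ B i j') ∧
      (∀ (i i' : Fin (m1+2)) (j : Fin (m2+2)), i ≤ i' → B i j ≤ B i' j) ∧
      max (max (linf R) (linf S)) (linf B) ≤ 4 * linf θ ∧
      linf B = B (Fin.last (m1+1)) (Fin.last (m2+1)) ∧
      B (Fin.last (m1+1)) (Fin.last (m2+1)) = Vtot θ) := by
  refine ⟨⟨(fun i _ => θ i 0, fun _ j => θ 0 j - θ 0 0,
    fun i j => θ i j - θ i 0 - θ 0 j + θ 0 0),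
    decompCond_iff.2 ⟨fun _ _ => rfl, fun _ _ => rfl, fun _ _ => rfl⟩, ?_⟩, ?_⟩
  · rintro ⟨R, S, B⟩ h
    obtain ⟨hR, hS, hB⟩ := decompCond_iff.1 h
    exact Prod.ext (by ext i j; exact hR i j)
      (Prod.ext (by ext i j; exact hS i j) (by ext i j; exact hB i j))
  · intro R S B h
    obtain ⟨hR, hS, hB⟩ := decompCond_iff.1 h
    have hrow (i : Fin (m1+2)) (j j' : Fin (m2+2)) (hj : j ≤ j') : B i j ≤ B i j' := by
      linarith [hB i j, hB i j', sub_le_sub_of_mem_antiMonge hθ (Fin.zero_le i) hj]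
    have hcol (i i' : Fin (m1+2)) (j : Fin (m2+2)) (hi : i ≤ i') : B i j ≤ B i' j := by
      linarith [hB i j, hB i' j, sub_le_sub_of_mem_antiMonge hθ hi (Fin.zero_le j)]
    have hnonneg i j : 0 ≤ B i j := by
      linarith [hB i j, sub_le_sub_of_mem_antiMonge hθ (Fin.zero_le i) (Fin.zero_le j)]
    have habs i j := abs_le.1 (abs_apply_le_linf θ i j)
    refine ⟨mem_antiMonge_iff.2 fun a b => ?_, hrow, hcol, max_le (max_le ?_ ?_) ?_,
      le_antisymm (linf_le fun i j => ?_) ?_, ?_⟩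
    · linarith [mem_antiMonge_iff.1 hθ a b, hB a.succ b.succ, hB a.castSucc b.succ,
        hB a.succ b.castSucc, hB a.castSucc b.castSucc]
    · refine linf_le fun i j => abs_le.2 ?_
      rw [hR]
      constructor <;> linarith [(habs i 0).1, (habs i 0).2]
    · refine linf_le fun i j => abs_le.2 ?_
      rw [hS]
      constructor <;> linarith [(habs 0 j).1, (habs 0 j).2, (habs 0 0).1, (habs 0 0).2]
    · refine linf_le fun i j => abs_le.2 ?_
      rw [hB]
      constructor <;>
        linarith [(habs i j).1, (habs i j).2, (habs i 0).1, (habs i 0).2, (habs 0 j).1,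
          (habs 0 j).2, (habs 0 0).1, (habs 0 0).2]
    · rw [abs_of_nonneg (hnonneg i j)]
      exact (hrow i j _ (Fin.le_last j)).trans (hcol i _ _ (Fin.le_last i))
    · exact (le_abs_self _).trans (abs_apply_le_linf B _ _)
    · rw [hB, Vtot]
      ring
end
end

section
/- There exists a universal constant C > 0 such that for all integers n1 ≥ 2, n2 ≥ 2, every integer k ≥ 1, and all i ∈ {1,…,n1-1}, j ∈ {1,…,n2-1}: the sum over all pairs (ℓ, r) with ℓ ∈ {1,…,n1-1}, r ∈ {1,…,n2-1} and ℓ·r > k of [ sin(π i ℓ / n1)² · sin(π j r / n2)² ] / [ 4 n1 n2 · sin(π ℓ / (2 n1))² · sin(π r / (2 n2))² ] is at most C · log(n2) · min{ (min{i, n1-i}) · (min{j, n2-j}), n1 n2 / k }. -/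
open Real Finset

/-- One factor of the summand: the normalised ratio of squared sines. -/
noncomputable def sineRatio (n i l : ℕ) : ℝ :=
  Real.sin (π * i * l / n) ^ 2 / (2 * n * Real.sin (π * l / (2 * n)) ^ 2)

lemma sineRatio_nonneg (n i l : ℕ) : 0 ≤ sineRatio n i l := by
  unfold sineRatio; positivity

lemma div_le_sin_pi_mul_div {n l : ℕ} (hn : 0 < n) (hl : l ≤ n) :
    (l : ℝ) / n ≤ Real.sin (π * l / (2 * n)) := by
  have hn' : (0 : ℝ) < n := by exact_mod_cast hn
  have hl' : (l : ℝ) ≤ n := by exact_mod_cast hl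
  have hpi := Real.pi_pos
  have h : π * l / (2 * n) ≤ π / 2 := by
    rw [div_le_div_iff₀ (by positivity) (by positivity)]
    nlinarith
  refine le_of_eq_of_le ?_ (Real.mul_le_sin (by positivity) h)
  field_simp

/-- Jordan's inequality bounds the ratio by the numerator times `n / (2 l²)`. -/
lemma sineRatio_le_sin_sq_mul {n l : ℕ} (i : ℕ) (hl : 1 ≤ l) (hln : l ≤ n) :
    sineRatio n i l ≤ Real.sin (π * i * l / n) ^ 2 * (n / 2 * ((l : ℝ) ^ 2)⁻¹) := by
  have hn : 0 < n := by omega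
  have hn' : (0 : ℝ) < n := by exact_mod_cast hn
  have hl' : (0 : ℝ) < l := by exact_mod_cast hl
  unfold sineRatio
  calc _ ≤ Real.sin (π * i * l / n) ^ 2 / (2 * n * ((l : ℝ) / n) ^ 2) := by
        gcongr
        exact div_le_sin_pi_mul_div hn hln
    _ = _ := by field_simp

lemma sineRatio_le_inv_sq {n l : ℕ} (i : ℕ) (hl : 1 ≤ l) (hln : l ≤ n) :
    sineRatio n i l ≤ n / 2 * ((l : ℝ) ^ 2)⁻¹ :=
  (sineRatio_le_sin_sq_mul i hl hln).trans
    (mul_le_of_le_one_left (by positivity) (Real.sin_sq_le_one _))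

lemma sin_sq_pi_mul_sub {n i : ℕ} (l : ℕ) (hn : 0 < n) (hi : i ≤ n) :
    Real.sin (π * (n - i : ℕ) * l / n) ^ 2 = Real.sin (π * i * l / n) ^ 2 := by
  have hn' : (n : ℝ) ≠ 0 := by positivity
  have h : π * (n - i : ℕ) * l / n = l * π - π * i * l / n := by
    rw [Nat.cast_sub hi]; field_simp
  rw [h, Real.sin_nat_mul_pi_sub, neg_sq, mul_pow, ← pow_mul, mul_comm l 2, pow_mul]
  simp

lemma sin_sq_le_min_mul_sq {n i : ℕ} (l : ℕ) (hn : 0 < n) (hi : i ≤ n) :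
    Real.sin (π * i * l / n) ^ 2 ≤ (π * (min i (n - i) : ℕ) * l / n) ^ 2 := by
  rcases min_choice i (n - i) with h | h <;> rw [h]
  · exact Real.sin_sq_le_sq
  · rw [← sin_sq_pi_mul_sub l hn hi]
    exact Real.sin_sq_le_sq

lemma sineRatio_le_min_sq {n i l : ℕ} (hi : i ≤ n) (hl : 1 ≤ l) (hln : l ≤ n) :
    sineRatio n i l ≤ 5 * ((min i (n - i) : ℕ) : ℝ) ^ 2 / n := by
  have hn : 0 < n := by omega
  have hn' : (0 : ℝ) < n := by exact_mod_cast hn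
  have hl' : (0 : ℝ) < l := by exact_mod_cast hl
  have hpi : π ^ 2 ≤ 10 := by nlinarith [Real.pi_lt_d2, Real.pi_pos]
  calc sineRatio n i l
      ≤ (π * (min i (n - i) : ℕ) * l / n) ^ 2 * (n / 2 * ((l : ℝ) ^ 2)⁻¹) :=
        (sineRatio_le_sin_sq_mul i hl hln).trans
          (mul_le_mul_of_nonneg_right (sin_sq_le_min_mul_sq l hn hi) (by positivity))
    _ = π ^ 2 / 2 * ((min i (n - i) : ℕ) : ℝ) ^ 2 / n := by field_simp
    _ ≤ _ := by gcongr; linarith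

/-- The full one-dimensional sum is at most a constant times `min i (n - i)`; the small indices
are controlled by `|sin x| ≤ |x|`, the large ones by the tail of `∑ 1 / l²`. -/
lemma sum_sineRatio_le {n i : ℕ} (hi : 1 ≤ i) (hin : i < n) :
    ∑ l ∈ Finset.Icc 1 (n - 1), sineRatio n i l ≤ 6 * ((min i (n - i) : ℕ) : ℝ) := by
  set m := min i (n - i) with hm
  have hm0 : 0 < m := by omega
  have hn' : (0 : ℝ) < n := by exact_mod_cast (by omega : 0 < n)
  have hm' : (0 : ℝ) < m := by exact_mod_cast hm0
  rw [← Finset.sum_filter_add_sum_filter_not _ (fun l => l ≤ n / m)]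
  have small : ∑ l ∈ (Finset.Icc 1 (n - 1)).filter (fun l => l ≤ n / m), sineRatio n i l
      ≤ 5 * (m : ℝ) := by
    have hc : ((#((Finset.Icc 1 (n - 1)).filter (fun l => l ≤ n / m)) : ℕ) : ℝ) ≤ n / m := by
      refine le_trans ?_ (Nat.cast_div_le (α := ℝ) (m := n) (n := m))
      have : (Finset.Icc 1 (n - 1)).filter (fun l => l ≤ n / m) ⊆ Finset.Icc 1 (n / m) := by
        intro l; simp only [Finset.mem_filter, Finset.mem_Icc]; omega
      exact_mod_cast (Finset.card_le_card this).trans (by simp)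
    calc _ ≤ #((Finset.Icc 1 (n - 1)).filter (fun l => l ≤ n / m)) • (5 * (m : ℝ) ^ 2 / n) := by
          refine Finset.sum_le_card_nsmul _ _ _ fun l hl => ?_
          simp only [Finset.mem_filter, Finset.mem_Icc] at hl
          exact sineRatio_le_min_sq hin.le hl.1.1 (by omega)
      _ ≤ n / m * (5 * (m : ℝ) ^ 2 / n) := by
          rw [nsmul_eq_mul]; gcongr
      _ = _ := by field_simp
  have large : ∑ l ∈ (Finset.Icc 1 (n - 1)).filter (fun l => ¬ l ≤ n / m), sineRatio n i l
      ≤ m := by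
    have hK : (n : ℝ) / m ≤ (n / m : ℕ) + 1 := by
      rw [div_le_iff₀ hm']
      exact_mod_cast (Nat.lt_div_mul_add (a := n) hm0).le.trans (by rw [add_mul, one_mul])
    calc _ ≤ ∑ l ∈ (Finset.Icc 1 (n - 1)).filter (fun l => ¬ l ≤ n / m),
            n / 2 * ((l : ℝ) ^ 2)⁻¹ := by
          refine Finset.sum_le_sum fun l hl => ?_
          simp only [Finset.mem_filter, Finset.mem_Icc] at hl
          exact sineRatio_le_inv_sq i hl.1.1 (by omega)
      _ ≤ ∑ l ∈ Finset.Ioo (n / m) n, n / 2 * ((l : ℝ) ^ 2)⁻¹ := by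
          refine Finset.sum_le_sum_of_subset_of_nonneg ?_ fun _ _ _ => by positivity
          intro l; simp only [Finset.mem_filter, Finset.mem_Icc, Finset.mem_Ioo]; omega
      _ ≤ n / 2 * (2 / ((n / m : ℕ) + 1)) := by
          rw [← Finset.mul_sum]; gcongr; exact sum_Ioo_inv_sq_le _ _
      _ ≤ n / 2 * (2 / (n / m)) := by gcongr
      _ = m := by field_simp
  linarith

/-- The truncated double sum of `1 / (l r)²` over `l r > k`. -/
lemma sum_inv_sq_mul_inv_sq_le {k : ℕ} (a b : ℕ) (hk : 1 ≤ k) :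
    ∑ p ∈ (Finset.Icc 1 a ×ˢ Finset.Icc 1 b).filter (fun p => k < p.1 * p.2),
      ((p.1 : ℝ) ^ 2)⁻¹ * ((p.2 : ℝ) ^ 2)⁻¹ ≤ 2 / k * (1 + Real.log b) := by
  have hk' : (0 : ℝ) < k := by exact_mod_cast hk
  have inner : ∀ r ∈ Finset.Icc 1 b, ∑ l ∈ Finset.Icc 1 a,
      (if k < l * r then ((l : ℝ) ^ 2)⁻¹ * ((r : ℝ) ^ 2)⁻¹ else 0) ≤ 2 / k * (r : ℝ)⁻¹ := by
    intro r hr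
    have hr0 : 0 < r := (Finset.mem_Icc.1 hr).1
    have hr' : (0 : ℝ) < r := by exact_mod_cast hr0
    have hK : (k : ℝ) / r ≤ (k / r : ℕ) + 1 := by
      rw [div_le_iff₀ hr']
      exact_mod_cast (Nat.lt_div_mul_add (a := k) hr0).le.trans (by rw [add_mul, one_mul])
    rw [← Finset.sum_filter]
    calc _ ≤ ∑ l ∈ Finset.Ioo (k / r) (a + 1), ((l : ℝ) ^ 2)⁻¹ * ((r : ℝ) ^ 2)⁻¹ := by
          refine Finset.sum_le_sum_of_subset_of_nonneg ?_ fun _ _ _ => by positivity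
          intro l
          simp only [Finset.mem_filter, Finset.mem_Icc, Finset.mem_Ioo,
            Nat.div_lt_iff_lt_mul hr0]
          omega
      _ ≤ 2 / ((k / r : ℕ) + 1) * ((r : ℝ) ^ 2)⁻¹ := by
          rw [← Finset.sum_mul]; gcongr; exact sum_Ioo_inv_sq_le _ _
      _ ≤ 2 / (k / r) * ((r : ℝ) ^ 2)⁻¹ := by gcongr
      _ = _ := by field_simp
  rw [Finset.sum_filter, Finset.sum_product_right]
  refine (Finset.sum_le_sum inner).trans ?_
  rw [← Finset.mul_sum]
  gcongr
  simpa [harmonic_eq_sum_Icc] using harmonic_le_one_add_log b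

/-- Lemma 5.3 (variance proxy bound): for all `n1, n2 ≥ 2`, `k ≥ 1`, and
`i ∈ {1,…,n1-1}`, `j ∈ {1,…,n2-1}`, the sum over pairs `(ℓ, r)` with `ℓ r > k` of
`sin(πiℓ/n1)² sin(πjr/n2)² / (4 n1 n2 sin(πℓ/(2n1))² sin(πr/(2n2))²)` is at most
`C log(n2) min{ (i ∧ (n1-i)) (j ∧ (n2-j)), n1 n2 / k }`. -/
theorem sine_sum_variance_proxy_bound :
    ∃ C : ℝ, 0 < C ∧
      ∀ (n1 n2 k i j : ℕ), 2 ≤ n1 → 2 ≤ n2 → 1 ≤ k →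
        1 ≤ i → i ≤ n1 - 1 → 1 ≤ j → j ≤ n2 - 1 →
        (∑ p ∈ (Finset.Icc 1 (n1-1) ×ˢ Finset.Icc 1 (n2-1)).filter
            (fun p => k < p.1 * p.2),
          Real.sin (π * i * p.1 / n1) ^ 2 * Real.sin (π * j * p.2 / n2) ^ 2 /
            (4 * n1 * n2 * Real.sin (π * p.1 / (2 * n1)) ^ 2 *
              Real.sin (π * p.2 / (2 * n2)) ^ 2))
        ≤ C * Real.log n2 *
            min (((min i (n1 - i) * min j (n2 - j) : ℕ) : ℝ)) ((n1 * n2 : ℝ) / k) := by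
  refine ⟨72, by norm_num, fun n1 n2 k i j hn1 hn2 hk hi hin hj hjn => ?_⟩
  have hlog : 1 / 2 ≤ Real.log n2 := by
    have h2 : Real.log 2 ≤ Real.log n2 :=
      Real.log_le_log (by norm_num) (by exact_mod_cast hn2)
    linarith [Real.log_two_gt_d9]
  have hk' : (0 : ℝ) < k := by exact_mod_cast hk
  have term : ∀ p : ℕ × ℕ,
      Real.sin (π * i * p.1 / n1) ^ 2 * Real.sin (π * j * p.2 / n2) ^ 2 /
        (4 * n1 * n2 * Real.sin (π * p.1 / (2 * n1)) ^ 2 *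
          Real.sin (π * p.2 / (2 * n2)) ^ 2) = sineRatio n1 i p.1 * sineRatio n2 j p.2 := by
    intro p
    rw [sineRatio, sineRatio, div_mul_div_comm]
    congr 1; ring
  rw [Finset.sum_congr rfl fun p _ => term p, mul_min_of_nonneg _ _ (by positivity)]
  refine le_min ?_ ?_
  · calc _ ≤ ∑ p ∈ Finset.Icc 1 (n1 - 1) ×ˢ Finset.Icc 1 (n2 - 1),
            sineRatio n1 i p.1 * sineRatio n2 j p.2 :=
          Finset.sum_le_sum_of_subset_of_nonneg (Finset.filter_subset _ _)
            fun p _ _ => mul_nonneg (sineRatio_nonneg _ _ _) (sineRatio_nonneg _ _ _)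
      _ = (∑ l ∈ Finset.Icc 1 (n1 - 1), sineRatio n1 i l) *
            ∑ r ∈ Finset.Icc 1 (n2 - 1), sineRatio n2 j r := by
          rw [Finset.sum_mul_sum, Finset.sum_product]
      _ ≤ (6 * ((min i (n1 - i) : ℕ) : ℝ)) * (6 * ((min j (n2 - j) : ℕ) : ℝ)) :=
          mul_le_mul (sum_sineRatio_le hi (by omega)) (sum_sineRatio_le hj (by omega))
            (Finset.sum_nonneg fun _ _ => sineRatio_nonneg _ _ _) (by positivity)
      _ = 36 * ((min i (n1 - i) * min j (n2 - j) : ℕ) : ℝ) := by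
          rw [Nat.cast_mul]; ring
      _ ≤ _ := by gcongr; linarith
  · have hb : Real.log ((n2 - 1 : ℕ) : ℝ) ≤ Real.log n2 :=
      Real.log_le_log (by exact_mod_cast (by omega : 0 < n2 - 1))
        (by exact_mod_cast Nat.sub_le n2 1)
    calc _ ≤ ∑ p ∈ (Finset.Icc 1 (n1 - 1) ×ˢ Finset.Icc 1 (n2 - 1)).filter
              (fun p => k < p.1 * p.2),
            (n1 * n2 : ℝ) / 4 * (((p.1 : ℝ) ^ 2)⁻¹ * ((p.2 : ℝ) ^ 2)⁻¹) := by
          refine Finset.sum_le_sum fun p hp => ?_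
          simp only [Finset.mem_filter, Finset.mem_product, Finset.mem_Icc] at hp
          refine (mul_le_mul (sineRatio_le_inv_sq i hp.1.1.1 (by omega))
            (sineRatio_le_inv_sq j hp.1.2.1 (by omega)) (sineRatio_nonneg _ _ _)
            (by positivity)).trans_eq ?_
          ring
      _ ≤ (n1 * n2 : ℝ) / 4 * (2 / k * (1 + Real.log (n2 - 1 : ℕ))) := by
          rw [← Finset.mul_sum]; gcongr; exact sum_inv_sq_mul_inv_sq_le _ _ hk
      _ = (1 + Real.log (n2 - 1 : ℕ)) / 2 * ((n1 * n2 : ℝ) / k) := by ring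
      _ ≤ _ := by gcongr; linarith
end

section
/- Let θ̄ ∈ ℝ^{n1×n2} be anti-Monge (D θ̄ D̃ᵀ ≥ 0 entrywise) and suppose every row of θ̄ sums to zero, i.e., Σ_{ℓ=1}^{n2} θ̄_{i,ℓ} = 0 for all i. Define f(i, j) = Σ_{k=1}^{n2} (θ̄_{i,k} - θ̄_{j,k})². Then f(i, m) + f(m, j) ≤ f(i, j) for all 1 ≤ i ≤ m ≤ j ≤ n1. -/
open Matrix

noncomputable section

lemma diffMat_mulVec (m : ℕ) (x : Fin (m+2) → ℝ) (i : Fin (m+1)) :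
    ∑ j, diffMat m i j * x j = x i.succ - x i.castSucc := by
  have h : ∀ j, diffMat m i j * x j =
      (if j = i.succ then x j else 0) - (if j = i.castSucc then x j else 0) := by
    intro j
    have hne : i.castSucc ≠ i.succ := (Fin.castSucc_lt_succ).ne
    simp only [diffMat, Matrix.of_apply]
    split_ifs <;> simp_all
  simp [h, Finset.sum_sub_distrib]

lemma diffMat_mul_mul_transpose_apply (m1 m2 : ℕ)
    (θ : Matrix (Fin (m1+2)) (Fin (m2+2)) ℝ) (a : Fin (m1+1)) (b : Fin (m2+1)) :
    (diffMat m1 * θ * (diffMat m2)ᵀ) a b =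
      (θ a.succ b.succ - θ a.castSucc b.succ) -
        (θ a.succ b.castSucc - θ a.castSucc b.castSucc) := by
  have h : (diffMat m1 * θ * (diffMat m2)ᵀ) a b =
      ∑ l, diffMat m2 b l * (diffMat m1 * θ) a l := by
    rw [Matrix.mul_apply]
    exact Finset.sum_congr rfl fun l _ => mul_comm _ _
  rw [h, diffMat_mulVec]
  simp only [Matrix.mul_apply]
  rw [diffMat_mulVec m1 (fun i => θ i b.succ), diffMat_mulVec m1 (fun i => θ i b.castSucc)]

/-- Row differences of an anti-Monge matrix are monotone. -/
lemma monotone_row_sub (m1 m2 : ℕ) (θ : Matrix (Fin (m1+2)) (Fin (m2+2)) ℝ)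
    (hθ : ∀ (a : Fin (m1+1)) (b : Fin (m2+1)),
      0 ≤ (diffMat m1 * θ * (diffMat m2)ᵀ) a b)
    {i j : Fin (m1+2)} (hij : i ≤ j) : Monotone fun k => θ j k - θ i k := by
  refine Fin.monotone_iff_le_succ.2 fun b => ?_
  have hcol : Monotone fun i => θ i b.succ - θ i b.castSucc := by
    refine Fin.monotone_iff_le_succ.2 fun a => ?_
    have h := hθ a b
    rw [diffMat_mul_mul_transpose_apply] at h
    linarith
  have h := hcol hij
  simp only at h ⊢
  linarith

/-- Lemma 5.9: for an anti-Monge matrix `θ̄` whose rows sum to zero, the squared row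
distances `f(i,j) = Σ_k (θ̄_{i,k} - θ̄_{j,k})²` are superadditive along the order:
`f(i,m) + f(m,j) ≤ f(i,j)` for `i ≤ m ≤ j`. -/
theorem row_dist_superadditive (m1 m2 : ℕ) (θ : Matrix (Fin (m1+2)) (Fin (m2+2)) ℝ)
    (hθ : ∀ (a : Fin (m1+1)) (b : Fin (m2+1)),
      0 ≤ (diffMat m1 * θ * (diffMat m2)ᵀ) a b)
    (hrow : ∀ i, ∑ l, θ i l = 0) :
    ∀ i m j : Fin (m1+2), i ≤ m → m ≤ j →
      (∑ k, (θ i k - θ m k) ^ 2) + (∑ k, (θ m k - θ j k) ^ 2)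
        ≤ ∑ k, (θ i k - θ j k) ^ 2 := by
  intro i m j him hmj
  have hcheb := ((monotone_row_sub m1 m2 θ hθ him).monovary
    (monotone_row_sub m1 m2 θ hθ hmj)).sum_mul_sum_le_card_mul_sum
  simp only [Finset.sum_sub_distrib, hrow, sub_self, mul_zero] at hcheb
  have hcross : 0 ≤ ∑ k, (θ m k - θ i k) * (θ j k - θ m k) :=
    nonneg_of_mul_nonneg_right hcheb (by simp [Fintype.card_fin]; positivity)
  have hexp : ∑ k, (θ i k - θ j k) ^ 2 =
      (∑ k, (θ i k - θ m k) ^ 2) + (∑ k, (θ m k - θ j k) ^ 2) +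
        2 * ∑ k, (θ m k - θ i k) * (θ j k - θ m k) := by
    rw [Finset.mul_sum, ← Finset.sum_add_distrib, ← Finset.sum_add_distrib]
    exact Finset.sum_congr rfl fun k _ => by ring
  linarith
end
end

section
/- For every anti-Monge matrix θ ∈ M ⊂ ℝ^{n1×n2} and every positive integer r, there exists a matrix θ̃ ∈ ℝ^{n1×n2} of rank at most 3r + 3 such that ‖θ̃ - θ‖_F² ≤ 2 (n1 n2 / r³) V(θ)². -/
open Matrix

noncomputable section

/-- Squared Frobenius norm. -/
def frobSq {a b : ℕ} (M : Matrix (Fin a) (Fin b) ℝ) : ℝ := ∑ i, ∑ j, (M i j) ^ 2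

/-- Telescoping along the increments of `x`, between `p` and `i`. -/
theorem sub_eq_sum_increments {m : ℕ} (x : Fin (m + 2) → ℝ) {p i : Fin (m + 2)} (hpi : p ≤ i) :
    x i - x p = ∑ c : Fin (m + 1),
      (if p ≤ c.castSucc ∧ c.castSucc < i then (1 : ℝ) else 0) * (x c.succ - x c.castSucc) := by
  have key : ∀ i : Fin (m + 2), x i - x 0 = ∑ c : Fin (m + 1),
      (if c.castSucc < i then (1 : ℝ) else 0) * (x c.succ - x c.castSucc) := by
    intro i
    induction i using Fin.induction with
    | zero => simp
    | succ i ih =>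
      have hsplit : ∀ c : Fin (m + 1), (if c.castSucc < i.succ then (1 : ℝ) else 0) =
          (if c.castSucc < i.castSucc then 1 else 0) + if c = i then 1 else 0 := by
        intro c
        simp only [Fin.lt_def, Fin.ext_iff, Fin.val_castSucc, Fin.val_succ]
        split_ifs <;> first | omega | simp
      simp only [hsplit, add_mul, Finset.sum_add_distrib, ← ih]
      simp
  have hdiff : x i - x p = (x i - x 0) - (x p - x 0) := by ring
  rw [hdiff, key i, key p, ← Finset.sum_sub_distrib]
  refine Finset.sum_congr rfl fun c _ => ?_
  rw [← sub_mul]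
  congr 1
  simp only [Fin.lt_def, Fin.le_def] at *
  split_ifs <;> first | omega | simp

theorem diffMat_mul_apply_s16 {m n : ℕ} (A : Matrix (Fin (m + 2)) (Fin n) ℝ) (c : Fin (m + 1))
    (j : Fin n) : (diffMat m * A) c j = A c.succ j - A c.castSucc j := by
  have h : ∀ i : Fin (m + 2), diffMat m c i * A i j =
      (if i = c.succ then A i j else 0) - if i = c.castSucc then A i j else 0 := by
    intro i
    simp only [diffMat, Matrix.of_apply]
    split_ifs with h1 h2
    · exact absurd (h1.symm.trans h2) (by simp [Fin.ext_iff])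
    all_goals simp
  simp [Matrix.mul_apply, h, Finset.sum_sub_distrib]

theorem diffMat_mul_mul_transpose_apply_s16 {m n : ℕ} (A : Matrix (Fin (m + 2)) (Fin (n + 2)) ℝ)
    (c : Fin (m + 1)) (d : Fin (n + 1)) :
    (diffMat m * A * (diffMat n)ᵀ) c d =
      (A c.succ d.succ - A c.castSucc d.succ) - (A c.succ d.castSucc - A c.castSucc d.castSucc) := by
  rw [← Matrix.transpose_apply (diffMat m * A * (diffMat n)ᵀ), Matrix.transpose_mul,
    Matrix.transpose_transpose, diffMat_mul_apply_s16]
  simp [diffMat_mul_apply_s16]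

/-- The mixed increment of `A` over a box is the sum of the mixed differences inside it. -/
theorem mixed_increment_eq_sum {m n : ℕ} (A : Matrix (Fin (m + 2)) (Fin (n + 2)) ℝ)
    {p i : Fin (m + 2)} {q j : Fin (n + 2)} (hp : p ≤ i) (hq : q ≤ j) :
    (A i j - A p j) - (A i q - A p q) = ∑ c : Fin (m + 1), ∑ d : Fin (n + 1),
      (if p ≤ c.castSucc ∧ c.castSucc < i then (1 : ℝ) else 0) *
      (if q ≤ d.castSucc ∧ d.castSucc < j then (1 : ℝ) else 0) *
      (diffMat m * A * (diffMat n)ᵀ) c d := by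
  rw [sub_eq_sum_increments (fun k => A k j) hp, sub_eq_sum_increments (fun k => A k q) hp,
    ← Finset.sum_sub_distrib]
  refine Finset.sum_congr rfl fun c _ => ?_
  rw [← mul_sub, show A c.succ j - A c.castSucc j - (A c.succ q - A c.castSucc q) = _ from
    sub_eq_sum_increments (fun l => A c.succ l - A c.castSucc l) hq, Finset.mul_sum]
  refine Finset.sum_congr rfl fun d _ => ?_
  rw [diffMat_mul_mul_transpose_apply_s16, mul_assoc]

theorem sum_sum_mul_mul_comm {ι κ α β : Type*} [Fintype ι] [Fintype κ] [Fintype α] [Fintype β]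
    (u : ι → α → ℝ) (v : κ → β → ℝ) (μ : α → β → ℝ) :
    ∑ i, ∑ j, ∑ c, ∑ d, u i c * v j d * μ c d =
      ∑ c, ∑ d, (∑ i, u i c) * (∑ j, v j d) * μ c d := by
  have h : ∀ i, ∑ j, ∑ c, ∑ d, u i c * v j d * μ c d =
      ∑ c, ∑ d, u i c * (∑ j, v j d) * μ c d := by
    intro i
    rw [Finset.sum_comm]
    refine Finset.sum_congr rfl fun c _ => ?_
    rw [Finset.sum_comm]
    simp only [Finset.mul_sum, Finset.sum_mul]
  simp only [h]
  rw [Finset.sum_comm]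
  refine Finset.sum_congr rfl fun c _ => ?_
  rw [Finset.sum_comm]
  simp only [Finset.sum_mul]

theorem matrix_rank_add_le {m n : ℕ} (A B : Matrix (Fin m) (Fin n) ℝ) :
    (A + B).rank ≤ A.rank + B.rank := by
  have hle : LinearMap.range (A + B).mulVecLin ≤
      LinearMap.range A.mulVecLin ⊔ LinearMap.range B.mulVecLin := by
    rw [Matrix.mulVecLin_add]
    exact LinearMap.range_add_le _ _
  exact (Submodule.finrank_mono hle).trans (Submodule.finrank_add_le_finrank_add_finrank _ _)

/-- A matrix whose rows depend only on a label in `Fin K` has rank at most `K`. -/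
theorem rank_submatrix_le_of_label {m n K : ℕ} (N : Matrix (Fin K) (Fin n) ℝ)
    (a : Fin m → Fin K) : (N.submatrix a id).rank ≤ K := by
  have h : N.submatrix a id = (1 : Matrix (Fin K) (Fin K) ℝ).submatrix a id * N := by
    ext i j
    simp [Matrix.mul_apply, Matrix.one_apply]
  rw [h]
  exact (Matrix.rank_mul_le_right _ _).trans (Matrix.rank_le_height N)

/-- A labelling has a choice of least representatives of its classes. -/
theorem exists_least_representative {n K : ℕ} (a : Fin (n + 1) → Fin K) :
    ∃ g : Fin K → Fin (n + 1), ∀ i, g (a i) ≤ i ∧ a (g (a i)) = a i := by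
  have h : ∀ k : Fin K, ∃ s : Fin (n + 1), ∀ i, a i = k → s ≤ i ∧ a s = k := by
    intro k
    by_cases hk : ∃ i, a i = k
    · obtain ⟨s, hs, hmin⟩ := (Set.toFinite {i | a i = k}).exists_minimal hk
      refine ⟨s, fun i hi => ⟨?_, hs⟩⟩
      rcases le_total s i with hsi | his
      · exact hsi
      · exact hmin hi his
    · exact ⟨0, fun i hi => absurd ⟨i, hi⟩ hk⟩
  choose g hg using h
  exact ⟨g, fun i => hg (a i) i rfl⟩

theorem sub_mul_le_of_div_eq {i p r n : ℕ} (hn : 0 < n) (h : p * r / n = i * r / n) :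
    (i - p) * r ≤ n := by
  have h1 := Nat.div_add_mod (p * r) n
  have h2 := Nat.div_add_mod (i * r) n
  have h3 := Nat.mod_lt (i * r) hn
  rw [h] at h1
  rw [Nat.sub_mul]
  omega

/-- If every `i` is close to its representative `p i`, then each increment is used by few `i`. -/
theorem sum_indicator_mul_le {m r : ℕ} (p : Fin (m + 2) → Fin (m + 2))
    (hp : ∀ i : Fin (m + 2), ((i : ℕ) - p i) * r ≤ m + 2) (c : Fin (m + 1)) :
    (∑ i, if p i ≤ c.castSucc ∧ c.castSucc < i then (1 : ℝ) else 0) * r ≤ (m : ℝ) + 2 := by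
  rw [Finset.sum_boole]
  rcases (Finset.univ.filter fun i => p i ≤ c.castSucc ∧ c.castSucc < i).eq_empty_or_nonempty
    with h | h
  · rw [h]
    simp
    positivity
  · obtain ⟨t, ht, hmax⟩ := Finset.exists_max_image _ (fun i => i) h
    have hsub : (Finset.univ.filter fun i => p i ≤ c.castSucc ∧ c.castSucc < i) ⊆
        Finset.Ioc (p t) t := by
      intro i hi
      have h1 := hmax i hi
      simp only [Finset.mem_filter, Finset.mem_univ, true_and] at hi ht
      exact Finset.mem_Ioc.2 ⟨ht.1.trans_lt hi.2, h1⟩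
    have hcard := Finset.card_le_card hsub
    rw [Fin.card_Ioc] at hcard
    exact_mod_cast (Nat.mul_le_mul_right r hcard).trans (hp t)

theorem sub_le_div_of_floor_eq {x y V : ℝ} {r : ℕ} (hr : 1 ≤ r) (hy : 0 ≤ y) (hyx : y ≤ x)
    (hxV : x ≤ V) (h : ⌊y * r / V⌋₊ = ⌊x * r / V⌋₊) : x - y ≤ V / r := by
  have hr' : (0 : ℝ) < r := by exact_mod_cast hr
  rcases (hy.trans (hyx.trans hxV)).eq_or_lt with hV | hV
  · subst hV
    simp only [zero_div]
    linarith
  · have h1 := Nat.lt_floor_add_one (x * r / V)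
    have h2 := Nat.floor_le (show 0 ≤ y * r / V by positivity)
    rw [h] at h2
    have h3 : x * r / V - y * r / V < 1 := by linarith
    rw [← sub_div, div_lt_one hV] at h3
    rw [le_div_iff₀ hr']
    linarith

/-- A partition of the indices into `r` classes of small diameter. -/
theorem exists_position_label (m : ℕ) {r : ℕ} (hr : 1 ≤ r) :
    ∃ b : Fin (m + 2) → Fin r, ∃ g : Fin r → Fin (m + 2), ∀ i,
      g (b i) ≤ i ∧ ((i : ℕ) - g (b i)) * r ≤ m + 2 := by
  have hlt : ∀ i : Fin (m + 2), (i : ℕ) * r / (m + 2) < r := fun i =>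
    (Nat.div_lt_iff_lt_mul (by omega)).2 (by rw [mul_comm]; exact Nat.mul_lt_mul_of_pos_left i.2 hr)
  obtain ⟨g, hg⟩ := exists_least_representative fun i => (⟨(i : ℕ) * r / (m + 2), hlt i⟩ : Fin r)
  exact ⟨_, g, fun i => ⟨(hg i).1,
    sub_mul_le_of_div_eq (by omega) (congrArg Fin.val (hg i).2)⟩⟩

/-- A partition of the indices into at most `2r + 1` classes which have small diameter and on
which the monotone function `R` varies little. -/
theorem exists_position_mass_label {m r : ℕ} (hr : 1 ≤ r) {R : Fin (m + 2) → ℝ} {V : ℝ}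
    (hR : Monotone R) (h0 : ∀ i, 0 ≤ R i) (hV : ∀ i, R i ≤ V) :
    ∃ a : Fin (m + 2) → Fin (2 * r + 1), ∃ g : Fin (2 * r + 1) → Fin (m + 2), ∀ i,
      g (a i) ≤ i ∧ ((i : ℕ) - g (a i)) * r ≤ m + 2 ∧ R i - R (g (a i)) ≤ V / r := by
  have hV0 : 0 ≤ V := (h0 0).trans (hV 0)
  have hpos : ∀ i : Fin (m + 2), (i : ℕ) * r / (m + 2) ≤ r := fun i =>
    Nat.div_le_of_le_mul (Nat.mul_le_mul_right r i.2.le)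
  have hmass : ∀ i, ⌊R i * r / V⌋₊ ≤ r := by
    intro i
    refine Nat.floor_le_of_le (div_le_of_le_mul₀ hV0 (Nat.cast_nonneg r) ?_)
    rw [mul_comm]
    exact mul_le_mul_of_nonneg_left (hV i) (Nat.cast_nonneg r)
  have hlt : ∀ i : Fin (m + 2), (i : ℕ) * r / (m + 2) + ⌊R i * r / V⌋₊ < 2 * r + 1 := by
    intro i
    have := hpos i
    have := hmass i
    omega
  obtain ⟨g, hg⟩ := exists_least_representative fun i => (⟨_, hlt i⟩ : Fin (2 * r + 1))
  refine ⟨fun i => ⟨_, hlt i⟩, g, fun i => ?_⟩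
  obtain ⟨hle, heq⟩ := hg i
  replace heq := congrArg Fin.val heq
  generalize g _ = p at hle heq ⊢
  simp only at heq
  have hd : (p : ℕ) * r / (m + 2) ≤ (i : ℕ) * r / (m + 2) :=
    Nat.div_le_div_right (Nat.mul_le_mul_right r hle)
  have hf : ⌊R p * r / V⌋₊ ≤ ⌊R i * r / V⌋₊ := by
    refine Nat.floor_le_floor ?_
    have := hR hle
    gcongr
  exact ⟨hle, sub_mul_le_of_div_eq (by omega) (by omega),
    sub_le_div_of_floor_eq hr (h0 p) (hR hle) (hV i) (by omega)⟩

/-- Proposition 3.5 (low-rank approximation of anti-Monge matrices): for every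
`θ ∈ M` and every positive integer `r` there is a matrix of rank at most `3r + 3`
within squared Frobenius distance `2 n1 n2 V(θ)² / r³`. -/
theorem low_rank_approx (m1 m2 : ℕ) (θ : Matrix (Fin (m1+2)) (Fin (m2+2)) ℝ)
    (hθ : θ ∈ antiMonge m1 m2) (r : ℕ) (hr : 1 ≤ r) :
    ∃ θt : Matrix (Fin (m1+2)) (Fin (m2+2)) ℝ,
      θt.rank ≤ 3 * r + 3 ∧
      frobSq (θt - θ) ≤ 2 * ((((m1:ℝ) + 2) * ((m2:ℝ) + 2)) / (r:ℝ) ^ 3) * (Vtot θ) ^ 2 := by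
  have hr' : (0 : ℝ) < r := by exact_mod_cast hr
  have hbox : ∀ {p i : Fin (m1 + 2)} {q j : Fin (m2 + 2)}, p ≤ i → q ≤ j →
      0 ≤ (θ i j - θ p j) - (θ i q - θ p q) := by
    intro p i q j hp hq
    rw [mixed_increment_eq_sum θ hp hq]
    refine Finset.sum_nonneg fun c _ => Finset.sum_nonneg fun d _ => mul_nonneg ?_ (hθ c d)
    split_ifs <;> simp
  set L := Fin.last (m2 + 1)
  set R : Fin (m1 + 2) → ℝ := fun i => (θ i L - θ 0 L) - (θ i 0 - θ 0 0)
  have hR : Monotone R := by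
    intro p i hpi
    have := hbox hpi (Fin.zero_le L)
    simp only [R]
    linarith
  have hR0 : ∀ i, 0 ≤ R i := fun i => hbox (Fin.zero_le i) (Fin.zero_le L)
  have hRlast : R (Fin.last (m1 + 1)) = Vtot θ := by
    simp only [R, Vtot, L]
    ring
  have hRV : ∀ i, R i ≤ Vtot θ := fun i => hRlast ▸ hR (Fin.le_last i)
  have hV0 : 0 ≤ Vtot θ := (hR0 0).trans (hRV 0)
  obtain ⟨a, g, hg⟩ := exists_position_mass_label hr hR hR0 hRV
  obtain ⟨b, h, hh⟩ := exists_position_label m2 hr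
  set E : Fin (m1 + 2) → Fin (m2 + 2) → ℝ := fun i j =>
    (θ i j - θ (g (a i)) j) - (θ i (h (b j)) - θ (g (a i)) (h (b j)))
  have hE0 : ∀ i j, 0 ≤ E i j := fun i j => hbox (hg i).1 (hh j).1
  have hEle : ∀ i j, E i j ≤ Vtot θ / r := by
    intro i j
    have h1 := hbox (hg i).1 (Fin.le_last j)
    have h2 := hbox (hg i).1 (Fin.zero_le (h (b j)))
    have h3 := (hg i).2.2
    simp only [R, E, L] at *
    linarith
  have hμ : ∑ c, ∑ d, (diffMat m1 * θ * (diffMat m2)ᵀ) c d = Vtot θ := by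
    have := mixed_increment_eq_sum θ (Fin.zero_le (Fin.last (m1 + 1))) (Fin.zero_le L)
    simp only [L, Fin.zero_le, Fin.castSucc_lt_last, and_self, if_true, one_mul] at this
    rw [← this, Vtot]
    ring
  have hsum : ∑ i, ∑ j, E i j ≤ ((m1 : ℝ) + 2) / r * (((m2 : ℝ) + 2) / r) * Vtot θ := by
    calc ∑ i, ∑ j, E i j
        = ∑ c : Fin (m1 + 1), ∑ d : Fin (m2 + 1),
          (∑ i, if g (a i) ≤ c.castSucc ∧ c.castSucc < i then (1 : ℝ) else 0) *
          (∑ j, if h (b j) ≤ d.castSucc ∧ d.castSucc < j then (1 : ℝ) else 0) *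
          (diffMat m1 * θ * (diffMat m2)ᵀ) c d := by
          simp only [E, fun i j => mixed_increment_eq_sum θ (hg i).1 (hh j).1]
          exact sum_sum_mul_mul_comm
            (fun i c => if g (a i) ≤ Fin.castSucc c ∧ Fin.castSucc c < i then (1 : ℝ) else 0)
            (fun j d => if h (b j) ≤ Fin.castSucc d ∧ Fin.castSucc d < j then (1 : ℝ) else 0) _
      _ ≤ ∑ c : Fin (m1 + 1), ∑ d : Fin (m2 + 1),
          ((m1 : ℝ) + 2) / r * (((m2 : ℝ) + 2) / r) *
          (diffMat m1 * θ * (diffMat m2)ᵀ) c d := by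
          refine Finset.sum_le_sum fun c _ => Finset.sum_le_sum fun d _ =>
            mul_le_mul_of_nonneg_right (mul_le_mul ?_ ?_ ?_ (by positivity)) (hθ c d)
          · exact (le_div_iff₀ hr').2 (sum_indicator_mul_le _ (fun i => (hg i).2.1) c)
          · exact (le_div_iff₀ hr').2 (sum_indicator_mul_le _ (fun j => (hh j).2) d)
          · exact Finset.sum_nonneg fun j _ => by split_ifs <;> simp
      _ = _ := by simp only [← Finset.mul_sum, hμ]
  let A : Matrix (Fin (m1 + 2)) (Fin (m2 + 2)) ℝ := (θ.submatrix g id).submatrix a id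
  let B : Matrix (Fin (m2 + 2)) (Fin (m1 + 2)) ℝ :=
    (Matrix.of fun k i => θ i (h k) - θ (g (a i)) (h k)).submatrix b id
  refine ⟨A + Bᵀ, ?_, ?_⟩
  · have hA : A.rank ≤ 2 * r + 1 := rank_submatrix_le_of_label _ a
    have hB : Bᵀ.rank ≤ r := (Matrix.rank_transpose B).trans_le (rank_submatrix_le_of_label _ b)
    have := matrix_rank_add_le A Bᵀ
    omega
  · calc frobSq (A + Bᵀ - θ) = ∑ i, ∑ j, E i j * E i j := by
          refine Finset.sum_congr rfl fun i _ => Finset.sum_congr rfl fun j _ => ?_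
          simp only [A, B, E, Matrix.sub_apply, Matrix.add_apply, Matrix.transpose_apply,
            Matrix.submatrix_apply, Matrix.of_apply, id]
          ring
      _ ≤ ∑ i, ∑ j, Vtot θ / r * E i j := by
          gcongr with i _ j _
          · exact hE0 i j
          · exact hEle i j
      _ = Vtot θ / r * ∑ i, ∑ j, E i j := by simp only [Finset.mul_sum]
      _ ≤ Vtot θ / r * (((m1 : ℝ) + 2) / r * (((m2 : ℝ) + 2) / r) * Vtot θ) := by gcongr
      _ = ((((m1:ℝ) + 2) * ((m2:ℝ) + 2)) / (r:ℝ) ^ 3) * (Vtot θ) ^ 2 := by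
          field_simp
      _ ≤ _ := by
          rw [mul_assoc]
          exact le_mul_of_one_le_left (by positivity) one_le_two
end
end
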